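/- Let H be a Hopf algebra over a field k and let E be a Hopf bimodule over H. Then the subspace of left-coinvariants ᴴE := {e ∈ E : e₍₋₁₎⊗e₍₀₎ = 1⊗e}, equipped with the right H-comodule structure inherited from E and with the new right H-action e ⋄ h := S(h₁)▷e◁h₂, is a right crossed H-module. -/

import Mathlib

/- STATEMENT 1: coinvariants of a Hopf bimodule form a Yetter-Drinfeld module. -/

open TensorProduct

noncomputable section

section Props
variable {k : Type} [Field k] {H : Type} [Ring H] [HopfAlgebra k H]
variable {V : Type} [AddCommGroup V] [Module k V]

/-- `ρ : V → V ⊗ H` is a right `H`-comodule structure. -/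
def IsRightCoaction (ρ : V →ₗ[k] V ⊗[k] H) : Prop :=
  (∀ v, (TensorProduct.rid k V)
      ((LinearMap.lTensor V (Coalgebra.counit (R := k) (A := H))) (ρ v)) = v) ∧
  (∀ v, (LinearMap.rTensor H ρ) (ρ v) =
    (TensorProduct.assoc k V H H).symm
      ((LinearMap.lTensor V (Coalgebra.comul (R := k) (A := H))) (ρ v)))

/-- `lam : V → H ⊗ V` is a left `H`-comodule structure. -/
def IsLeftCoaction (lam : V →ₗ[k] H ⊗[k] V) : Prop :=
  (∀ v, (TensorProduct.lid k V)
      ((LinearMap.rTensor V (Coalgebra.counit (R := k) (A := H))) (lam v)) = v) ∧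
  (∀ v, (LinearMap.lTensor H lam) (lam v) =
    (TensorProduct.assoc k H H V)
      ((LinearMap.rTensor V (Coalgebra.comul (R := k) (A := H))) (lam v)))

/-- `act : V ⊗ H → V` is a right `H`-module structure. -/
def IsRightAction (act : V ⊗[k] H →ₗ[k] V) : Prop :=
  (∀ v, act (v ⊗ₜ (1 : H)) = v) ∧
  (∀ (v : V) (a b : H), act (v ⊗ₜ (a * b)) = act (act (v ⊗ₜ a) ⊗ₜ b))

/-- `act : H ⊗ V → V` is a left `H`-module structure. -/
def IsLeftAction (act : H ⊗[k] V →ₗ[k] V) : Prop :=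
  (∀ v, act ((1 : H) ⊗ₜ v) = v) ∧
  (∀ (a b : H) (v : V), act ((a * b) ⊗ₜ v) = act (a ⊗ₜ act (b ⊗ₜ v)))

/-- Yetter-Drinfeld compatibility `v₍₀₎◁h₁ ⊗ v₍₁₎h₂ = (v◁h₂)₍₀₎ ⊗ h₁(v◁h₂)₍₁₎`. -/
def IsYetterDrinfeld (act : V ⊗[k] H →ₗ[k] V) (ρ : V →ₗ[k] V ⊗[k] H) : Prop :=
  (TensorProduct.map act (LinearMap.mul' k H)) ∘ₗ
      (tensorTensorTensorComm k V H H H).toLinearMap ∘ₗ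
      (TensorProduct.map ρ (Coalgebra.comul (R := k) (A := H))) =
  (LinearMap.lTensor V (LinearMap.mul' k H)) ∘ₗ
      (TensorProduct.leftComm k H V H).toLinearMap ∘ₗ
      (LinearMap.lTensor H ρ) ∘ₗ (LinearMap.lTensor H act) ∘ₗ
      (TensorProduct.leftComm k V H H).toLinearMap ∘ₗ
      (LinearMap.lTensor V (Coalgebra.comul (R := k) (A := H)))

end Props

variable (k : Type) [Field k] (H : Type) [Ring H] [HopfAlgebra k H]

/-- A Hopf bimodule structure on a fixed `k`-vector space `E`. -/
structure HopfBimoduleStr (E : Type) [AddCommGroup E] [Module k E] where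
  lact : H ⊗[k] E →ₗ[k] E
  ract : E ⊗[k] H →ₗ[k] E
  lam : E →ₗ[k] H ⊗[k] E
  ρ : E →ₗ[k] E ⊗[k] H
  lact_action : IsLeftAction lact
  ract_action : IsRightAction ract
  lam_coaction : IsLeftCoaction lam
  ρ_coaction : IsRightCoaction ρ
  acts_comm : ∀ (h : H) (v : E) (g : H), ract (lact (h ⊗ₜ v) ⊗ₜ g) = lact (h ⊗ₜ ract (v ⊗ₜ g))
  coacts_comm : ∀ v, (LinearMap.rTensor H lam) (ρ v) =
    (TensorProduct.assoc k H E H).symm ((LinearMap.lTensor H ρ) (lam v))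
  lact_lam : lam ∘ₗ lact =
    (TensorProduct.map (LinearMap.mul' k H) lact) ∘ₗ
      (tensorTensorTensorComm k H H H E).toLinearMap ∘ₗ
      (TensorProduct.map (Coalgebra.comul (R := k) (A := H)) lam)
  lact_ρ : ρ ∘ₗ lact =
    (TensorProduct.map lact (LinearMap.mul' k H)) ∘ₗ
      (tensorTensorTensorComm k H H E H).toLinearMap ∘ₗ
      (TensorProduct.map (Coalgebra.comul (R := k) (A := H)) ρ)
  ract_lam : lam ∘ₗ ract =
    (TensorProduct.map (LinearMap.mul' k H) ract) ∘ₗ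
      (tensorTensorTensorComm k H E H H).toLinearMap ∘ₗ
      (TensorProduct.map lam (Coalgebra.comul (R := k) (A := H)))
  ract_ρ : ρ ∘ₗ ract =
    (TensorProduct.map ract (LinearMap.mul' k H)) ∘ₗ
      (tensorTensorTensorComm k E H H H).toLinearMap ∘ₗ
      (TensorProduct.map ρ (Coalgebra.comul (R := k) (A := H)))

variable {k H}
variable {E : Type} [AddCommGroup E] [Module k E]

/-- The subspace of left coinvariants `ᴴE = {e : e₍₋₁₎ ⊗ e₍₀₎ = 1 ⊗ e}`. -/
def leftCoinvariants (D : HopfBimoduleStr k H E) : Submodule k E :=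
  LinearMap.ker (D.lam - (TensorProduct.mk k H E) 1)

/-- The new right action `e ⋄ h = S(h₁) ▷ e ◁ h₂`, as a map `E ⊗ H → E`. -/
def newRact (D : HopfBimoduleStr k H E) : E ⊗[k] H →ₗ[k] E :=
  D.lact ∘ₗ
    (TensorProduct.map (HopfAlgebra.antipode (R := k) (A := H)) D.ract) ∘ₗ
    (TensorProduct.leftComm k E H H).toLinearMap ∘ₗ
    (LinearMap.lTensor E (Coalgebra.comul (R := k) (A := H)))

open Coalgebra HopfAlgebra

section Convolution

variable {M : Type} [AddCommGroup M] [Module k M]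

/-- The convolution `h ↦ α (u h₁ ⊗ f h₂)`. -/
def convAct (α : H ⊗[k] M →ₗ[k] M) (u : H →ₗ[k] H) (f : H →ₗ[k] M) : H →ₗ[k] M :=
  α ∘ₗ TensorProduct.map u f ∘ₗ comul

theorem convAct_convAct {α : H ⊗[k] M →ₗ[k] M} (hα : IsLeftAction α) {u v : H →ₗ[k] H}
    (huv : LinearMap.mul' k H ∘ₗ TensorProduct.map u v ∘ₗ comul = Algebra.linearMap k H ∘ₗ counit)
    (f : H →ₗ[k] M) : convAct α u (convAct α v f) = f := by
  ext h
  have e₁ : convAct α u (convAct α v f) h =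
      (α ∘ₗ TensorProduct.map u (α ∘ₗ TensorProduct.map v f))
        (LinearMap.lTensor H comul (comul h)) := by
    change (α ∘ₗ TensorProduct.map u ((α ∘ₗ TensorProduct.map v f) ∘ₗ comul) ∘ₗ comul) h = _
    rw [← LinearMap.map_comp_lTensor]
    rfl
  have e₂ : (α ∘ₗ TensorProduct.map u (α ∘ₗ TensorProduct.map v f)) ∘ₗ
      (TensorProduct.assoc k H H H).toLinearMap =
      α ∘ₗ TensorProduct.map (LinearMap.mul' k H ∘ₗ TensorProduct.map u v) f := by
    ext a b c
    simp [hα.2]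
  have e₃ : TensorProduct.map (LinearMap.mul' k H ∘ₗ TensorProduct.map u v) f
      (LinearMap.rTensor H comul (comul h)) = (1 : H) ⊗ₜ f h := by
    rw [← LinearMap.comp_apply, LinearMap.map_comp_rTensor, LinearMap.comp_assoc, huv,
      ← LinearMap.map_comp_rTensor, LinearMap.comp_apply, rTensor_counit_comul]
    simp
  rw [e₁, ← coassoc_apply]
  refine (LinearMap.congr_fun e₂ (LinearMap.rTensor H comul (comul h))).trans ?_
  rw [LinearMap.comp_apply, e₃, hα.1]

theorem convAct_antipode_convAct_id {α : H ⊗[k] M →ₗ[k] M} (hα : IsLeftAction α)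
    (f : H →ₗ[k] M) : convAct α (antipode k) (convAct α LinearMap.id f) = f :=
  convAct_convAct hα mul_antipode_rTensor_comul f

theorem convAct_id_convAct_antipode {α : H ⊗[k] M →ₗ[k] M} (hα : IsLeftAction α)
    (f : H →ₗ[k] M) : convAct α LinearMap.id (convAct α (antipode k) f) = f :=
  convAct_convAct hα mul_antipode_lTensor_comul f

theorem convAct_id_injective {α : H ⊗[k] M →ₗ[k] M} (hα : IsLeftAction α) :
    Function.Injective (convAct α LinearMap.id) :=
  Function.LeftInverse.injective (convAct_antipode_convAct_id hα)

variable {N : Type} [AddCommGroup N] [Module k N]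

theorem convAct_comp {α : H ⊗[k] M →ₗ[k] M} {β : H ⊗[k] N →ₗ[k] N} {p : M →ₗ[k] N}
    (hp : p ∘ₗ α = β ∘ₗ LinearMap.lTensor H p) (f : H →ₗ[k] M) :
    convAct β LinearMap.id (p ∘ₗ f) = p ∘ₗ convAct α LinearMap.id f := by
  rw [convAct, convAct, ← LinearMap.comp_assoc _ α p, hp, ← LinearMap.lTensor_comp_map]
  rfl

/-- The diagonal action `h ▷ (x ⊗ y) = h₁ x ⊗ h₂ ▷ y` on `M ⊗ N`. -/
def diagAct (α : H ⊗[k] M →ₗ[k] M) (β : H ⊗[k] N →ₗ[k] N) :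
    H ⊗[k] (M ⊗[k] N) →ₗ[k] M ⊗[k] N :=
  TensorProduct.map α β ∘ₗ (tensorTensorTensorComm k H H M N).toLinearMap ∘ₗ
    LinearMap.rTensor (M ⊗[k] N) comul

theorem isLeftAction_mul' : IsLeftAction (LinearMap.mul' k H) :=
  ⟨fun v => by simp, fun a b v => by simp [mul_assoc]⟩

theorem IsLeftAction.diagAct {α : H ⊗[k] M →ₗ[k] M} {β : H ⊗[k] N →ₗ[k] N}
    (hα : IsLeftAction α) (hβ : IsLeftAction β) : IsLeftAction (diagAct α β) := by
  refine ⟨fun v => ?_, fun a b v => ?_⟩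
  · induction v with
    | zero => simp
    | add x y hx hy => rw [tmul_add, map_add, hx, hy]
    | tmul x y => simp [_root_.diagAct, Algebra.TensorProduct.one_def, hα.1, hβ.1]
  · induction v with
    | zero => simp
    | add x y hx hy => simp only [tmul_add, map_add, hx, hy]
    | tmul x y =>
      simp only [_root_.diagAct, LinearMap.comp_apply, LinearMap.rTensor_tmul,
        Bialgebra.comul_mul, LinearEquiv.coe_coe]
      induction comul (R := k) b with
      | zero => simp
      | add s t hs ht => simp only [mul_add, add_tmul, tmul_add, map_add, hs, ht]
      | tmul b₁ b₂ =>
        induction comul (R := k) a with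
        | zero => simp
        | add s t hs ht => simp only [add_mul, add_tmul, map_add, hs, ht]
        | tmul a₁ a₂ => simp [hα.2, hβ.2]

end Convolution

namespace HopfBimoduleStr

variable (D : HopfBimoduleStr k H E)

/-- The map `h ↦ e ◁ h`. -/
def ractBy (e : E) : H →ₗ[k] E := D.ract ∘ₗ TensorProduct.mk k E H e

/-- The map `h ↦ e ⋄ h`. -/
def newRactBy (e : E) : H →ₗ[k] E := newRact D ∘ₗ TensorProduct.mk k E H e

theorem newRactBy_eq (e : E) :
    D.newRactBy e = convAct D.lact (antipode k) (D.ractBy e) := by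
  ext h
  simp only [newRactBy, newRact, ractBy, convAct, LinearMap.comp_apply, TensorProduct.mk_apply,
    LinearMap.lTensor_tmul, LinearEquiv.coe_coe]
  induction comul (R := k) h with
  | zero => simp
  | add x y hx hy => simp only [tmul_add, map_add, hx, hy]
  | tmul x y => simp

theorem convAct_newRactBy (e : E) :
    convAct D.lact LinearMap.id (D.newRactBy e) = D.ractBy e := by
  rw [newRactBy_eq, convAct_id_convAct_antipode D.lact_action]

theorem mem_leftCoinvariants {e : E} : e ∈ leftCoinvariants D ↔ D.lam e = (1 : H) ⊗ₜ e := by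
  simp [leftCoinvariants, sub_eq_zero]

/-- The identity `h₁ ⊗ h₂ ▷ f h₃ = h₁ ⊗ (h ↦ h₁ ▷ f h₂) h₂`. -/
theorem convAct_diagAct_mul'_one (f : H →ₗ[k] E) :
    convAct (diagAct (LinearMap.mul' k H) D.lact) LinearMap.id (TensorProduct.mk k H E 1 ∘ₗ f) =
      LinearMap.lTensor H (convAct D.lact LinearMap.id f) ∘ₗ comul := by
  have e : diagAct (LinearMap.mul' k H) D.lact ∘ₗ
      TensorProduct.map LinearMap.id (TensorProduct.mk k H E 1 ∘ₗ f) =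
      LinearMap.lTensor H (D.lact ∘ₗ LinearMap.lTensor H f) ∘ₗ
        (TensorProduct.assoc k H H H).toLinearMap ∘ₗ LinearMap.rTensor H comul := by
    ext a b
    simp only [diagAct, AlgebraTensorModule.curry_apply, curry_apply, LinearMap.coe_restrictScalars,
      LinearMap.comp_apply, map_tmul, LinearMap.id_apply, mk_apply, LinearMap.rTensor_tmul,
      LinearEquiv.coe_coe]
    induction comul (R := k) a with
    | zero => simp
    | add s t hs ht => simp only [add_tmul, map_add, hs, ht]
    | tmul s t => simp
  rw [convAct, ← LinearMap.comp_assoc, e]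
  ext h
  simp only [LinearMap.comp_apply, LinearEquiv.coe_coe, coassoc_apply, convAct]
  rw [← LinearMap.comp_apply (LinearMap.lTensor H _) (LinearMap.lTensor H _),
    ← LinearMap.lTensor_comp, LinearMap.comp_assoc]
  rfl

theorem newRactBy_mem {e : E} (he : e ∈ leftCoinvariants D) (h : H) :
    D.newRactBy e h ∈ leftCoinvariants D := by
  have hlam : D.lam ∘ₗ D.lact =
      diagAct (LinearMap.mul' k H) D.lact ∘ₗ LinearMap.lTensor H D.lam := by
    rw [D.lact_lam]
    simp only [diagAct, LinearMap.comp_assoc, LinearMap.rTensor_comp_lTensor]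
  have key : D.lam ∘ₗ D.newRactBy e = TensorProduct.mk k H E 1 ∘ₗ D.newRactBy e := by
    apply convAct_id_injective (isLeftAction_mul'.diagAct D.lact_action)
    rw [convAct_comp hlam, convAct_diagAct_mul'_one, convAct_newRactBy]
    ext h
    have := LinearMap.congr_fun D.ract_lam (e ⊗ₜ h)
    simp only [LinearMap.comp_apply, map_tmul, D.mem_leftCoinvariants.1 he] at this
    simp only [LinearMap.comp_apply, ractBy, mk_apply, this, LinearEquiv.coe_coe]
    induction comul (R := k) h with
    | zero => simp
    | add s t hs ht => simp only [tmul_add, map_add, hs, ht]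
    | tmul s t => simp
  exact D.mem_leftCoinvariants.2 (LinearMap.congr_fun key h)

theorem newRact_mem {e : E} (he : e ∈ leftCoinvariants D) (h : H) :
    newRact D (e ⊗ₜ h) ∈ leftCoinvariants D :=
  D.newRactBy_mem he h

theorem ρ_mem {e : E} (he : e ∈ leftCoinvariants D) :
    D.ρ e ∈ LinearMap.range (LinearMap.rTensor H (leftCoinvariants D).subtype) := by
  have hex : Function.Exact (leftCoinvariants D).subtype (D.lam - TensorProduct.mk k H E 1) :=
    LinearMap.exact_subtype_ker_map _
  apply ((Module.Flat.rTensor_exact H hex) (D.ρ e)).1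
  have hsub (x : E ⊗[k] H) : LinearMap.rTensor H (D.lam - TensorProduct.mk k H E 1) x =
      LinearMap.rTensor H D.lam x - LinearMap.rTensor H (TensorProduct.mk k H E 1) x := by
    rw [LinearMap.rTensor_sub]
    rfl
  rw [hsub, D.coacts_comm, D.mem_leftCoinvariants.1 he,
    LinearMap.lTensor_tmul, sub_eq_zero]
  induction D.ρ e with
  | zero => simp
  | add x y hx hy => simp only [tmul_add, map_add, hx, hy]
  | tmul x y => simp

theorem newRact_tmul_one (e : E) : newRact D (e ⊗ₜ 1) = e := by
  simp [newRact, Algebra.TensorProduct.one_def, D.lact_action.1, D.ract_action.1]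

theorem newRact_tmul_mul (e : E) (a b : H) :
    newRact D (e ⊗ₜ (a * b)) = newRact D (newRact D (e ⊗ₜ a) ⊗ₜ b) := by
  simp only [newRact, LinearMap.comp_apply, LinearMap.lTensor_tmul, Bialgebra.comul_mul,
    LinearEquiv.coe_coe]
  induction comul (R := k) b with
  | zero => simp
  | add s t hs ht => simp only [mul_add, tmul_add, map_add, hs, ht]
  | tmul b₁ b₂ =>
    induction comul (R := k) a with
    | zero => simp
    | add s t hs ht => simp only [add_mul, add_tmul, tmul_add, map_add, hs, ht]
    | tmul a₁ a₂ =>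
      simp [antipode_mul_antidistrib, D.lact_action.2, D.ract_action.2, D.acts_comm]

/-- The action `h ▷ (e ⊗ y) = h ▷ e ⊗ y` on `E ⊗ H`. -/
def lactLeft : H ⊗[k] (E ⊗[k] H) →ₗ[k] E ⊗[k] H :=
  LinearMap.rTensor H D.lact ∘ₗ (TensorProduct.assoc k H E H).symm.toLinearMap

@[simp]
theorem lactLeft_tmul (h : H) (e : E) (y : H) :
    D.lactLeft (h ⊗ₜ (e ⊗ₜ y)) = D.lact (h ⊗ₜ e) ⊗ₜ y := rfl

theorem isLeftAction_lactLeft : IsLeftAction D.lactLeft := by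
  refine ⟨fun v => ?_, fun a b v => ?_⟩
  · induction v with
    | zero => simp
    | add x y hx hy => rw [tmul_add, map_add, hx, hy]
    | tmul x y => simp [D.lact_action.1]
  · induction v with
    | zero => simp
    | add x y hx hy => simp only [tmul_add, map_add, hx, hy]
    | tmul x y => simp [D.lact_action.2]

/-- The map `h ↦ p (e ⊗ h₁) ⊗ y h₂`, extended linearly in `e ⊗ y`. -/
def tmulComul (p : E ⊗[k] H →ₗ[k] E) (x : E ⊗[k] H) : H →ₗ[k] E ⊗[k] H :=
  TensorProduct.map p (LinearMap.mul' k H) ∘ₗ (tensorTensorTensorComm k E H H H).toLinearMap ∘ₗ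
    TensorProduct.mk k (E ⊗[k] H) (H ⊗[k] H) x ∘ₗ comul

theorem tmulComul_tmul (p : E ⊗[k] H →ₗ[k] E) (e : E) (y : H) :
    tmulComul p (e ⊗ₜ y) =
      TensorProduct.map (p ∘ₗ TensorProduct.mk k E H e) (LinearMap.mulLeft k y) ∘ₗ comul := by
  ext h
  simp only [tmulComul, LinearMap.comp_apply, mk_apply, LinearEquiv.coe_coe]
  induction comul (R := k) h with
  | zero => simp
  | add s t hs ht => simp only [tmul_add, map_add, hs, ht]
  | tmul s t => simp

theorem convAct_lactLeft_map (f : H →ₗ[k] E) (g : H →ₗ[k] H) :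
    convAct D.lactLeft LinearMap.id (TensorProduct.map f g ∘ₗ comul) =
      TensorProduct.map (convAct D.lact LinearMap.id f) g ∘ₗ comul := by
  have e₁ : convAct D.lactLeft LinearMap.id (TensorProduct.map f g ∘ₗ comul) =
      (D.lactLeft ∘ₗ TensorProduct.map LinearMap.id (TensorProduct.map f g)) ∘ₗ
        (LinearMap.lTensor H comul ∘ₗ comul) := by
    rw [convAct, ← LinearMap.id_comp (LinearMap.id (R := k) (M := H)), TensorProduct.map_comp]
    rfl
  have e₂ : (D.lactLeft ∘ₗ TensorProduct.map LinearMap.id (TensorProduct.map f g)) ∘ₗ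
      (TensorProduct.assoc k H H H).toLinearMap =
      TensorProduct.map (D.lact ∘ₗ TensorProduct.map LinearMap.id f) g := by
    ext a b c
    simp
  rw [e₁, ← Coalgebra.coassoc, ← LinearMap.comp_assoc, e₂, ← LinearMap.comp_assoc,
    LinearMap.map_comp_rTensor]
  rfl

theorem convAct_tmulComul_newRact (x : E ⊗[k] H) :
    convAct D.lactLeft LinearMap.id (tmulComul (newRact D) x) = tmulComul D.ract x := by
  induction x with
  | zero => ext; simp [convAct, tmulComul]
  | add x y hx hy =>
    have hadd (p : E ⊗[k] H →ₗ[k] E) : tmulComul p (x + y) = tmulComul p x + tmulComul p y := by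
      simp only [tmulComul, map_add, LinearMap.add_comp, LinearMap.comp_add]
    rw [hadd, hadd, ← hx, ← hy]
    simp only [convAct, TensorProduct.map_add_right, LinearMap.add_comp, LinearMap.comp_add]
  | tmul e y =>
    rw [tmulComul_tmul, tmulComul_tmul, convAct_lactLeft_map]
    exact congrArg (fun f => TensorProduct.map f _ ∘ₗ comul) (D.convAct_newRactBy e)

theorem tmulComul_ρ (e : E) : tmulComul D.ract (D.ρ e) = D.ρ ∘ₗ D.ractBy e := by
  ext h
  exact (LinearMap.congr_fun D.ract_ρ (e ⊗ₜ h)).symm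

/-- The map `h ↦ x₍₀₎ ⊗ h₁ x₍₁₎` with `x = f h₂`. -/
def mulComulρ (f : H →ₗ[k] E) : H →ₗ[k] E ⊗[k] H :=
  LinearMap.lTensor E (LinearMap.mul' k H) ∘ₗ (TensorProduct.leftComm k H E H).toLinearMap ∘ₗ
    TensorProduct.map LinearMap.id (D.ρ ∘ₗ f) ∘ₗ comul

theorem convAct_mulComulρ (f : H →ₗ[k] E) :
    convAct D.lactLeft LinearMap.id (D.mulComulρ f) =
      D.ρ ∘ₗ convAct D.lact LinearMap.id f := by
  have hρ : D.ρ ∘ₗ D.lact = diagAct D.lact (LinearMap.mul' k H) ∘ₗ LinearMap.lTensor H D.ρ := by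
    rw [D.lact_ρ]
    simp only [diagAct, LinearMap.comp_assoc, LinearMap.rTensor_comp_lTensor]
  rw [← convAct_comp hρ]
  set g := D.ρ ∘ₗ f
  let p : H ⊗[k] H →ₗ[k] E ⊗[k] H := LinearMap.lTensor E (LinearMap.mul' k H) ∘ₗ
    (TensorProduct.leftComm k H E H).toLinearMap ∘ₗ TensorProduct.map LinearMap.id g
  have e₁ : convAct D.lactLeft LinearMap.id (D.mulComulρ f) =
      (D.lactLeft ∘ₗ LinearMap.lTensor H p) ∘ₗ (LinearMap.lTensor H comul ∘ₗ comul) := by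
    have : D.mulComulρ f = p ∘ₗ comul := rfl
    rw [this, convAct, ← LinearMap.lTensor, LinearMap.lTensor_comp]
    rfl
  have e₂ : (D.lactLeft ∘ₗ LinearMap.lTensor H p) ∘ₗ (TensorProduct.assoc k H H H).toLinearMap ∘ₗ
      LinearMap.rTensor H comul =
      diagAct D.lact (LinearMap.mul' k H) ∘ₗ TensorProduct.map LinearMap.id g := by
    ext a b
    simp only [p, diagAct, AlgebraTensorModule.curry_apply, curry_apply,
      LinearMap.coe_restrictScalars, LinearMap.comp_apply, map_tmul, LinearMap.id_apply,
      LinearMap.rTensor_tmul, LinearEquiv.coe_coe]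
    induction comul (R := k) a with
    | zero => simp
    | add s t hs ht => simp only [add_tmul, map_add, hs, ht]
    | tmul s t =>
      simp only [assoc_tmul, LinearMap.lTensor_tmul, LinearMap.comp_apply, map_tmul,
        LinearMap.id_apply, LinearEquiv.coe_coe]
      induction g b with
      | zero => simp
      | add x y hx hy => simp only [tmul_add, map_add, hx, hy]
      | tmul x y => simp
  rw [e₁, ← Coalgebra.coassoc]
  simp only [← LinearMap.comp_assoc] at e₂ ⊢
  rw [e₂]
  rfl

theorem isYetterDrinfeld_newRact : IsYetterDrinfeld (newRact D) D.ρ := by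
  ext e h
  have key : tmulComul (newRact D) (D.ρ e) = D.mulComulρ (D.newRactBy e) := by
    apply convAct_id_injective D.isLeftAction_lactLeft
    rw [convAct_tmulComul_newRact, tmulComul_ρ, convAct_mulComulρ, convAct_newRactBy]
  refine (LinearMap.congr_fun key h).trans ?_
  simp only [mulComulρ, newRactBy, LinearMap.comp_apply, LinearEquiv.coe_coe,
    AlgebraTensorModule.curry_apply, curry_apply, LinearMap.coe_restrictScalars,
    LinearMap.lTensor_tmul]
  induction comul (R := k) h with
  | zero => simp
  | add s t hs ht => simp only [tmul_add, map_add, hs, ht]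
  | tmul s t => simp

/-- The action `e ⋄ h` on the left coinvariants. -/
def coinvAct : leftCoinvariants D ⊗[k] H →ₗ[k] leftCoinvariants D :=
  LinearMap.codRestrict (leftCoinvariants D)
    (newRact D ∘ₗ LinearMap.rTensor H (leftCoinvariants D).subtype) fun x => by
      induction x with
      | zero => simp
      | add x y hx hy => rw [map_add]; exact add_mem hx hy
      | tmul e h => exact D.newRact_mem e.2 h

theorem rTensor_subtype_injective (X : Type) [AddCommGroup X] [Module k X] :
    Function.Injective (LinearMap.rTensor X (leftCoinvariants D).subtype) :=
  Module.Flat.rTensor_preserves_injective_linearMap _ (Submodule.subtype_injective _)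

/-- The coaction on the left coinvariants. -/
def coinvCoact : leftCoinvariants D →ₗ[k] leftCoinvariants D ⊗[k] H :=
  (LinearEquiv.ofInjective _ (D.rTensor_subtype_injective H)).symm.toLinearMap ∘ₗ
    LinearMap.codRestrict _ (D.ρ ∘ₗ (leftCoinvariants D).subtype) fun e => D.ρ_mem e.2

theorem rTensor_subtype_coinvCoact (e : leftCoinvariants D) :
    LinearMap.rTensor H (leftCoinvariants D).subtype (D.coinvCoact e) = D.ρ e :=
  congrArg Subtype.val
    ((LinearEquiv.ofInjective _ (D.rTensor_subtype_injective H)).apply_symm_apply _)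

theorem isRightAction_coinvAct : IsRightAction D.coinvAct :=
  ⟨fun v => Subtype.ext (D.newRact_tmul_one v),
    fun v a b => Subtype.ext (D.newRact_tmul_mul v a b)⟩

theorem isRightCoaction_coinvCoact : IsRightCoaction D.coinvCoact := by
  refine ⟨fun v => Subtype.ext ?_, fun v => ?_⟩
  · have h := D.ρ_coaction.1 v
    rw [← rTensor_subtype_coinvCoact] at h
    refine Eq.trans ?_ h
    induction D.coinvCoact v with
    | zero => simp
    | add x y hx hy => simp only [map_add, Submodule.coe_add, hx, hy]
    | tmul x y => simp
  · apply D.rTensor_subtype_injective (H ⊗[k] H) |>.comp (TensorProduct.assoc k _ H H).injective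
    apply (TensorProduct.assoc k E H H).symm.injective
    have h := D.ρ_coaction.2 v
    rw [← rTensor_subtype_coinvCoact] at h
    refine Eq.trans ?_ (h.trans ?_)
    · induction D.coinvCoact v with
      | zero => simp
      | add x y hx hy => simp only [map_add, Function.comp_apply] at hx hy ⊢; rw [hx, hy]
      | tmul x y =>
        simp only [Function.comp_apply, LinearMap.rTensor_tmul, Submodule.subtype_apply]
        rw [← rTensor_subtype_coinvCoact]
        induction D.coinvCoact x with
        | zero => simp
        | add x y hx hy => simp only [map_add, add_tmul, hx, hy]
        | tmul x y => simp
    · induction D.coinvCoact v with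
      | zero => simp
      | add x y hx hy => simp only [map_add, Function.comp_apply] at hx hy ⊢; rw [hx, hy]
      | tmul x y => simp

theorem isYetterDrinfeld_coinv : IsYetterDrinfeld D.coinvAct D.coinvCoact := by
  ext e h
  apply D.rTensor_subtype_injective H
  have hYD := LinearMap.congr_fun D.isYetterDrinfeld_newRact ((e : E) ⊗ₜ h)
  simp only [LinearMap.comp_apply, LinearEquiv.coe_coe, map_tmul, LinearMap.lTensor_tmul,
    AlgebraTensorModule.curry_apply, curry_apply, LinearMap.coe_restrictScalars] at hYD ⊢
  refine Eq.trans ?_ (hYD.trans ?_)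
  · rw [← rTensor_subtype_coinvCoact]
    induction D.coinvCoact e with
    | zero => simp
    | add x y hx hy => simp only [add_tmul, map_add, hx, hy]
    | tmul x y =>
      induction comul (R := k) h with
      | zero => simp
      | add s t hs ht => simp only [tmul_add, map_add, hs, ht]
      | tmul s t => simp [coinvAct]
  · induction comul (R := k) h with
    | zero => simp
    | add s t hs ht => simp only [tmul_add, map_add, hs, ht]
    | tmul s t =>
      simp only [leftComm_tmul, LinearMap.lTensor_tmul]
      have : newRact D ((e : E) ⊗ₜ t) = D.coinvAct (e ⊗ₜ t) := rfl
      rw [this, ← rTensor_subtype_coinvCoact]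
      induction D.coinvCoact (D.coinvAct (e ⊗ₜ t)) with
      | zero => simp
      | add x y hx hy => simp only [tmul_add, map_add, hx, hy]
      | tmul x y => simp

end HopfBimoduleStr

/-- For a Hopf bimodule `E` over a Hopf algebra `H`, the space of
left coinvariants `ᴴE`, with the inherited right coaction and the right action
`e ⋄ h = S(h₁) ▷ e ◁ h₂`, is a right crossed `H`-module (Yetter-Drinfeld module). -/
theorem leftCoinvariants_crossedModule (D : HopfBimoduleStr k H E) :
    (∀ e ∈ leftCoinvariants D, ∀ h : H, newRact D (e ⊗ₜ h) ∈ leftCoinvariants D) ∧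
    (∀ e ∈ leftCoinvariants D,
      D.ρ e ∈ LinearMap.range (LinearMap.rTensor H (leftCoinvariants D).subtype)) ∧
    (∃ (act' : (leftCoinvariants D) ⊗[k] H →ₗ[k] leftCoinvariants D)
        (ρ' : (leftCoinvariants D) →ₗ[k] (leftCoinvariants D) ⊗[k] H),
      (∀ (e : leftCoinvariants D) (h : H),
        (act' (e ⊗ₜ h) : E) = newRact D ((e : E) ⊗ₜ h)) ∧
      (∀ e : leftCoinvariants D,
        (LinearMap.rTensor H (leftCoinvariants D).subtype) (ρ' e) = D.ρ (e : E)) ∧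
      IsRightAction act' ∧ IsRightCoaction ρ' ∧ IsYetterDrinfeld act' ρ') := by
  exact ⟨fun e he h => D.newRact_mem he h, fun e he => D.ρ_mem he, D.coinvAct, D.coinvCoact,
    fun _ _ => rfl, D.rTensor_subtype_coinvCoact, D.isRightAction_coinvAct,
    D.isRightCoaction_coinvCoact, D.isYetterDrinfeld_coinv⟩
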